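/- Let I be a positive integer, τ > 0, λ₀ > 0, K > 0, and let λ_1, …, λ_I be positive reals. Then there exist constants C_I > 0 and ε_I ∈ (0,1), depending only on I, τ, λ₀, K and λ_1, …, λ_I, with the following property: for every ε ∈ (0, ε_I] and all nonnegative reals c_1, …, c_I such that c_k² ≤ √2 · λ_k e^{2τ² λ_k² + 2λτ} ε² + K λ_k² λ^{−2} for every k ∈ {1, …, I} and every λ ≥ λ₀, one has (Σ_{k=1}^{I} c_k²)^{1/2} ≤ C_I (log(1/ε))^{−1}. -/

import Mathlib

/-- Finite-dimensional engine of Theorem 6.1 of the paper. Given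
positive reals `λ_1, …, λ_I`, there are `C_I > 0` and `ε_I ∈ (0,1)` such that for
every `ε ∈ (0,ε_I]` and all nonnegative `c_1, …, c_I` with
`c_k² ≤ √2 λ_k e^{2τ²λ_k² + 2λτ} ε² + K λ_k² λ^{−2}` for every `k` and every
`λ ≥ λ₀`, one has `(Σ_{k=1}^I c_k²)^{1/2} ≤ C_I (log(1/ε))^{−1}`. -/
theorem finite_dimensional_heat_log_stability
    (I : ℕ) (hI : 0 < I) (τ lam0 K : ℝ) (hτ : 0 < τ) (hlam0 : 0 < lam0)
    (hK : 0 < K) (lam : Fin I → ℝ) (hpos : ∀ k, 0 < lam k) :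
    ∃ C > 0, ∃ εI : ℝ, 0 < εI ∧ εI < 1 ∧
      ∀ ε : ℝ, 0 < ε → ε ≤ εI → ∀ cc : Fin I → ℝ, (∀ k, 0 ≤ cc k) →
        (∀ k : Fin I, ∀ l : ℝ, lam0 ≤ l →
          cc k ^ 2 ≤ Real.sqrt 2 * lam k
              * Real.exp (2 * τ ^ 2 * (lam k) ^ 2 + 2 * l * τ) * ε ^ 2
            + K * (lam k) ^ 2 / l ^ 2) →
        Real.sqrt (∑ k : Fin I, cc k ^ 2) ≤ C * (Real.log (1 / ε))⁻¹ := by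
  have hne : (Finset.univ : Finset (Fin I)).Nonempty := ⟨⟨0, hI⟩, Finset.mem_univ _⟩
  set A : Fin I → ℝ := fun k =>
    2 * (Real.sqrt 2 * lam k * Real.exp (2 * τ ^ 2 * lam k ^ 2)) + 4 * K * τ ^ 2 * lam k ^ 2
    with hA
  have hApos : ∀ k, 0 < A k := fun k => by
    have := hpos k
    positivity
  refine ⟨Real.sqrt (∑ k, A k), Real.sqrt_pos.2 (Finset.sum_pos (fun k _ => hApos k) hne),
    Real.exp (-(2 * τ * lam0)), Real.exp_pos _, Real.exp_lt_one_iff.2 (by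
      have := mul_pos hτ hlam0
      linarith), ?_⟩
  intro ε hε hεI cc _ hbound
  obtain ⟨L, rfl⟩ : ∃ L, ε = Real.exp (-L) := ⟨-Real.log ε, by rw [neg_neg, Real.exp_log hε]⟩
  have hL : 2 * τ * lam0 ≤ L := neg_le_neg_iff.1 (Real.exp_le_exp.1 hεI)
  have hL0 : 0 < L := lt_of_lt_of_le (by positivity) hL
  have hlog : Real.log (1 / Real.exp (-L)) = L := by
    rw [one_div, ← Real.exp_neg, neg_neg, Real.log_exp]
  have hdecay : Real.exp (-L) ≤ 2 / L ^ 2 := by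
    rw [Real.exp_neg, inv_le_comm₀ (Real.exp_pos L) (by positivity), inv_div]
    have := Real.quadratic_le_exp_of_nonneg hL0.le
    linarith
  -- The choice `l = L / (2 * τ)` balances the two terms of the hypothesis.
  have hcoef : ∀ k, cc k ^ 2 ≤ A k / L ^ 2 := fun k => by
    have hk := hpos k
    have hl : lam0 ≤ L / (2 * τ) := by
      rw [le_div_iff₀ (by positivity)]
      linarith
    refine (hbound k _ hl).trans ?_
    have hexp : Real.exp (2 * τ ^ 2 * lam k ^ 2 + 2 * (L / (2 * τ)) * τ) * Real.exp (-L) ^ 2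
        = Real.exp (2 * τ ^ 2 * lam k ^ 2) * Real.exp (-L) := by
      rw [← Real.exp_nat_mul, ← Real.exp_add, ← Real.exp_add]
      congr 1
      push_cast
      field_simp
      ring
    calc _ = Real.sqrt 2 * lam k * Real.exp (2 * τ ^ 2 * lam k ^ 2) * Real.exp (-L)
          + 4 * K * τ ^ 2 * lam k ^ 2 / L ^ 2 := by
            rw [mul_assoc, hexp, mul_assoc (Real.sqrt 2 * lam k)]
            congr 1
            field_simp
            ring
      _ ≤ Real.sqrt 2 * lam k * Real.exp (2 * τ ^ 2 * lam k ^ 2) * (2 / L ^ 2)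
          + 4 * K * τ ^ 2 * lam k ^ 2 / L ^ 2 := by gcongr
      _ = A k / L ^ 2 := by
            simp only [hA]
            ring
  rw [hlog, ← div_eq_mul_inv]
  calc Real.sqrt (∑ k, cc k ^ 2) ≤ Real.sqrt ((∑ k, A k) / L ^ 2) := by
        rw [Finset.sum_div]
        exact Real.sqrt_le_sqrt (Finset.sum_le_sum fun k _ => hcoef k)
    _ = Real.sqrt (∑ k, A k) / L := by
        rw [Real.sqrt_div' _ (by positivity), Real.sqrt_sq hL0.le]
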